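/- (Davenport–Hasse multiplication formula.) Let n be a positive integer dividing q−1. For every multiplicative character α of κ: g(αⁿ) = αⁿ(n) · ∏_{φ : φⁿ = ε} g(αφ)/g(φ), where the product runs over all multiplicative characters φ of κ with φⁿ = ε, and αⁿ(n) denotes the character αⁿ evaluated at the element n·1 of κ. -/

import Mathlib

/-!
Finite-field hypergeometric functions (Otsubo), basic definitions:
`κ` is a finite field with `q = Fintype.card κ` elements, `ψ` a fixed nontrivial
additive character, multiplicative characters are `MulChar κ ℂ` (extended by `0`
on `0`, with trivial character `1`).
-/

open scoped Classical

noncomputable section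

variable {κ : Type*} [Field κ] [Fintype κ]

instance : Fintype (MulChar κ ℂ) := Fintype.ofFinite _

/-- The Gauss sum `g(φ) = -∑_{x ∈ κ} ψ(x) φ(x)`. -/
def gS (ψ : AddChar κ ℂ) (φ : MulChar κ ℂ) : ℂ := -∑ x : κ, ψ x * φ x

/-- The variant `g°(φ) = q^{δ(φ)} · g(φ)`, where `δ(φ) = 1` iff `φ` is trivial. -/
def gSo (ψ : AddChar κ ℂ) (φ : MulChar κ ℂ) : ℂ :=
  (if φ = 1 then (Fintype.card κ : ℂ) else 1) * gS ψ φ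

/-- The Pochhammer symbol `(α)_ν = g(αν)/g(α)`. -/
def poch (ψ : AddChar κ ℂ) (α ν : MulChar κ ℂ) : ℂ := gS ψ (α * ν) / gS ψ α

/-- The variant Pochhammer symbol `(α)°_ν = g°(αν)/g°(α)`. -/
def pocho (ψ : AddChar κ ℂ) (α ν : MulChar κ ℂ) : ℂ := gSo ψ (α * ν) / gSo ψ α

section PowerSums

open PowerSeries in
/-- For a monic `f = ∏ (X - a)`, the power series `∑_{m ≥ 1} (∑ aᵐ) Xᵐ`, obtained as the
logarithmic derivative of the reversed polynomial. -/
def powerSumSeries {K : Type*} [Field K] (f : Polynomial K) : PowerSeries K :=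
  -(X * d⁄dX K (f.reverse : PowerSeries K)) * (f.reverse : PowerSeries K)⁻¹

/-- The `m`-th power sum of the roots of a monic polynomial. -/
def rootPowerSum {K : Type*} [Field K] (m : ℕ) (f : Polynomial K) : K :=
  PowerSeries.coeff m (powerSumSeries f)

variable {K : Type*} [Field K]

open Polynomial

lemma constantCoeff_reverse {f : K[X]} (hf : f.Monic) :
    PowerSeries.constantCoeff (f.reverse : PowerSeries K) = 1 := by
  rw [← PowerSeries.coeff_zero_eq_constantCoeff_apply, Polynomial.coeff_coe, coeff_zero_reverse,
    hf.leadingCoeff]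

lemma powerSumSeries_mul_reverse {f : K[X]} (hf : f.Monic) :
    powerSumSeries f * (f.reverse : PowerSeries K) =
      -(PowerSeries.X * PowerSeries.derivative K (f.reverse : PowerSeries K)) := by
  rw [powerSumSeries, mul_assoc, PowerSeries.inv_mul_cancel, mul_one]
  rw [constantCoeff_reverse hf]
  exact one_ne_zero

lemma reverse_coe_ne_zero {f : K[X]} (hf : f.Monic) : (f.reverse : PowerSeries K) ≠ 0 := by
  intro h
  have := constantCoeff_reverse hf
  simp [h] at this

lemma powerSumSeries_eq_of_mul {f : K[X]} (hf : f.Monic) {p : PowerSeries K}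
    (h : p * (f.reverse : PowerSeries K) =
      -(PowerSeries.X * PowerSeries.derivative K (f.reverse : PowerSeries K))) :
    powerSumSeries f = p :=
  mul_right_cancel₀ (reverse_coe_ne_zero hf) ((powerSumSeries_mul_reverse hf).trans h.symm)

lemma powerSumSeries_mul {f g : K[X]} (hf : f.Monic) (hg : g.Monic) :
    powerSumSeries (f * g) = powerSumSeries f + powerSumSeries g := by
  apply powerSumSeries_eq_of_mul (hf.mul hg)
  rw [reverse_mul_of_domain, Polynomial.coe_mul, Derivation.leibniz, smul_eq_mul, smul_eq_mul]
  linear_combination (g.reverse : PowerSeries K) * powerSumSeries_mul_reverse hf +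
    (f.reverse : PowerSeries K) * powerSumSeries_mul_reverse hg

lemma powerSumSeries_map {E : Type*} [Field E] (i : K →+* E) {f : K[X]} (hf : f.Monic) :
    powerSumSeries (f.map i) = PowerSeries.map i (powerSumSeries f) := by
  apply powerSumSeries_eq_of_mul (hf.map i)
  have hrev : (f.map i).reverse = f.reverse.map i := by
    rw [reverse, reverse, natDegree_map, reflect_map]
  have h := congrArg (PowerSeries.map i) (powerSumSeries_mul_reverse hf)
  rw [hrev, Polynomial.polynomial_map_coe]
  simp only [map_mul, map_neg, PowerSeries.map_X] at h
  rw [h]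
  congr 2
  ext n
  simp [PowerSeries.coeff_derivative]

lemma powerSumSeries_X_sub_C (a : K) :
    powerSumSeries (X - C a) = PowerSeries.mk fun m => if m = 0 then 0 else a ^ m := by
  apply powerSumSeries_eq_of_mul (monic_X_sub_C a)
  have hrev : (X - C a).reverse = 1 - C a * X := by
    rw [reverse, natDegree_X_sub_C, sub_eq_add_neg, ← C_neg, reflect_add, reflect_C]
    have : reflect 1 (X : K[X]) = 1 := by simp
    rw [this]
    simp [sub_eq_add_neg]
  rw [hrev]
  have : ((1 - C a * X : K[X]) : PowerSeries K) = 1 - PowerSeries.C a * PowerSeries.X := by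
    simp
  rw [this, mul_sub, ← mul_assoc, mul_comm _ (PowerSeries.C a)]
  ext m
  rcases m with _ | _ | m <;>
    simp [PowerSeries.coeff_succ_mul_X, mul_assoc, PowerSeries.coeff_X, PowerSeries.derivative_C]
  ring

lemma rootPowerSum_mul {f g : K[X]} (hf : f.Monic) (hg : g.Monic) (m : ℕ) :
    rootPowerSum m (f * g) = rootPowerSum m f + rootPowerSum m g := by
  simp [rootPowerSum, powerSumSeries_mul hf hg]

@[simp]
lemma rootPowerSum_one (m : ℕ) : rootPowerSum m (1 : K[X]) = 0 := by
  have := rootPowerSum_mul (monic_one (R := K)) monic_one m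
  simpa using this

lemma rootPowerSum_X_sub_C {m : ℕ} (hm : m ≠ 0) (a : K) :
    rootPowerSum m (X - C a) = a ^ m := by
  simp [rootPowerSum, powerSumSeries_X_sub_C, hm]

lemma rootPowerSum_multiset_prod {m : ℕ} (hm : m ≠ 0) (s : Multiset K) :
    rootPowerSum m (s.map fun a => X - C a).prod = (s.map fun a => a ^ m).sum := by
  induction s using Multiset.induction with
  | empty => simp
  | cons a s ih =>
    rw [Multiset.map_cons, Multiset.prod_cons, Multiset.map_cons, Multiset.sum_cons,
      rootPowerSum_mul (monic_X_sub_C a) (monic_multisetProd_X_sub_C s), ih,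
      rootPowerSum_X_sub_C hm]

lemma map_rootPowerSum_eq_sum_aroots {E : Type*} [Field E] [Algebra K E] {f : K[X]} (hf : f.Monic)
    (hs : (f.map (algebraMap K E)).Splits) {m : ℕ} (hm : m ≠ 0) :
    algebraMap K E (rootPowerSum m f) = ((f.aroots E).map fun a => a ^ m).sum := by
  rw [← rootPowerSum_multiset_prod hm, aroots,
    ← hs.eq_prod_roots_of_monic (hf.map _)]
  simp [rootPowerSum, powerSumSeries_map _ hf]

lemma rootPowerSum_add_C {n : ℕ} (hn : n ≠ 0) {f : K[X]} (hf : f.Monic) (hd : f.natDegree = n)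
    (c : K) : rootPowerSum n (f + C c) = rootPowerSum n f - n * c := by
  have hdeg : (C c).degree < f.degree := by
    refine degree_C_le.trans_lt ?_
    rw [← natDegree_pos_iff_degree_pos]
    omega
  have hf' : (f + C c).Monic := hf.add_of_left hdeg
  have hd' : (f + C c).natDegree = n := by rw [natDegree_add_C, hd]
  have hrev : ((f + C c).reverse : PowerSeries K) =
      (f.reverse : PowerSeries K) + PowerSeries.C c * PowerSeries.X ^ n := by
    rw [reverse, hd', reflect_add, reflect_C, reverse, hd]
    simp
  have h1 := powerSumSeries_mul_reverse hf
  have h2 := powerSumSeries_mul_reverse hf'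
  rw [hrev] at h2
  obtain ⟨k, rfl⟩ := Nat.exists_eq_add_one_of_ne_zero hn
  have hD : PowerSeries.derivative K (PowerSeries.C c * PowerSeries.X ^ (k + 1)) =
      PowerSeries.C c * (((k + 1 : ℕ) : PowerSeries K) * PowerSeries.X ^ k) := by
    rw [Derivation.leibniz, PowerSeries.derivative_C, PowerSeries.derivative_pow]
    simp [PowerSeries.derivative_X]
  rw [map_add, hD] at h2
  set R := (f.reverse : PowerSeries K) with hR
  set P := powerSumSeries f with hP
  set P' := powerSumSeries (f + C c) with hP'
  have hinv : R * R⁻¹ = 1 := by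
    apply PowerSeries.mul_inv_cancel
    rw [constantCoeff_reverse hf]
    exact one_ne_zero
  have h3 : P' = P + PowerSeries.X ^ (k + 1) *
      ((-(PowerSeries.C c * ((k + 1 : ℕ) : PowerSeries K)) - P' * PowerSeries.C c) * R⁻¹) := by
    linear_combination (P - P') * hinv + R⁻¹ * (h2 - h1)
  have hP'0 : PowerSeries.constantCoeff P' = 0 := by
    simp [hP', powerSumSeries]
  have h4 := congrArg (PowerSeries.coeff (k + 1)) h3
  rw [map_add, PowerSeries.coeff_X_pow_mul', if_pos le_rfl, Nat.sub_self,
    PowerSeries.coeff_zero_eq_constantCoeff_apply] at h4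
  simp only [map_mul, map_sub, map_neg, PowerSeries.constantCoeff_C, hP'0,
    PowerSeries.constantCoeff_inv, hR, constantCoeff_reverse hf, map_natCast] at h4
  rw [rootPowerSum, rootPowerSum, ← hP, ← hP', h4]
  push_cast
  ring

end PowerSums

section MonicPolynomials

open Polynomial Finset

variable {K : Type*} [Field K]

open UniqueFactorizationMonoid in
lemma pow_dvd_iff_le_count_normalizedFactors {f Q : K[X]} (hf : f ≠ 0) (hQ : Q.Monic)
    (hQi : Irreducible Q) (k : ℕ) : Q ^ k ∣ f ↔ k ≤ (normalizedFactors f).count Q := by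
  rw [pow_dvd_iff_le_emultiplicity, emultiplicity_eq_count_normalizedFactors hQi hf,
    hQ.normalize_eq_self]
  norm_cast

lemma apply_pow_of_mul {χ : K[X] → ℂ} (h1 : χ 1 = 1)
    (hχ : ∀ f g : K[X], f.Monic → g.Monic → χ (f * g) = χ f * χ g) {Q : K[X]} (hQ : Q.Monic)
    (k : ℕ) : χ (Q ^ k) = χ Q ^ k := by
  induction k with
  | zero => simpa using h1
  | succ k ih => rw [pow_succ, hχ _ _ (hQ.pow k) hQ, ih, pow_succ]

variable [Finite K]

lemma finite_setOf_monic_natDegree (K : Type*) [Field K] [Finite K] (d : ℕ) :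
    {f : K[X] | f.Monic ∧ f.natDegree = d}.Finite := by
  refine (Set.finite_range
    fun a : Fin d → K => X ^ d + ∑ i : Fin d, C (a i) * X ^ (i : ℕ)).subset ?_
  rintro f ⟨hf, rfl⟩
  refine ⟨fun i => f.coeff i, ?_⟩
  conv_rhs => rw [hf.as_sum]
  simp only [Finset.sum_range]

/-- The monic polynomials of degree `d` over a finite field. -/
def monicsOfDegree (K : Type*) [Field K] [Finite K] (d : ℕ) : Finset K[X] :=
  (finite_setOf_monic_natDegree K d).toFinset

@[simp]
lemma mem_monicsOfDegree {d : ℕ} {f : K[X]} :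
    f ∈ monicsOfDegree K d ↔ f.Monic ∧ f.natDegree = d := by
  simp [monicsOfDegree]

/-- The pairs `(Q, k)` with `Q` monic irreducible and `deg (Q ^ k) = i`, for `i ≠ 0`. -/
def primePowersOfDegree (K : Type*) [Field K] [Finite K] (i : ℕ) : Finset (K[X] × ℕ) :=
  {p ∈ (range (i + 1)).biUnion (monicsOfDegree K) ×ˢ range (i + 1) |
    Irreducible p.1 ∧ p.2 * p.1.natDegree = i}

lemma mem_primePowersOfDegree {i : ℕ} (hi : i ≠ 0) {p : K[X] × ℕ} :
    p ∈ primePowersOfDegree K i ↔ p.1.Monic ∧ Irreducible p.1 ∧ p.2 * p.1.natDegree = i := by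
  simp only [primePowersOfDegree, mem_filter, mem_product, mem_biUnion, mem_range,
    mem_monicsOfDegree]
  constructor
  · rintro ⟨⟨⟨_, _, h, _⟩, _⟩, h1, h2⟩
    exact ⟨h, h1, h2⟩
  · rintro ⟨h, h1, h2⟩
    have h3 := h1.natDegree_pos
    have h4 : p.2 ≠ 0 := by
      rintro h
      simp [h] at h2
      exact hi h2.symm
    have h5 := Nat.le_mul_of_pos_left p.1.natDegree (Nat.pos_of_ne_zero h4)
    have h6 := Nat.le_mul_of_pos_right p.2 h3
    exact ⟨⟨⟨_, by omega, h, rfl⟩, by omega⟩, h1, h2⟩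

/-- The sum of `χ` over the monic polynomials of degree `d`. -/
def monicSum (χ : K[X] → ℂ) (d : ℕ) : ℂ := ∑ f ∈ monicsOfDegree K d, χ f

/-- The sum of `deg Q · χ(Q)ᵏ` over the prime powers `Qᵏ` of degree `i`. -/
def primePowerSum (χ : K[X] → ℂ) (i : ℕ) : ℂ :=
  ∑ p ∈ primePowersOfDegree K i, p.1.natDegree * χ p.1 ^ p.2

open UniqueFactorizationMonoid in
lemma sum_natDegree_primePowers_dvd {d : ℕ} {f : K[X]} (hf : f.Monic) (hd : f.natDegree = d) :
    ∑ i ∈ Icc 1 d, ∑ p ∈ primePowersOfDegree K i with p.1 ^ p.2 ∣ f, p.1.natDegree = d := by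
  have hmonic : ∀ Q ∈ normalizedFactors f, Q.Monic := fun Q hQ => by
    rw [← normalize_normalized_factor Q hQ]
    exact monic_normalize (prime_of_normalized_factor Q hQ).ne_zero
  have hprod : (normalizedFactors f).prod = f := by
    have h := prod_normalizedFactors_eq hf.ne_zero
    rwa [hf.normalize_eq_self] at h
  have hdeg : ∑ Q ∈ (normalizedFactors f).toFinset, ∑ k ∈ Icc 1 ((normalizedFactors f).count Q),
      Q.natDegree = d := by
    rw [← hd]
    conv_rhs => rw [← hprod, natDegree_multiset_prod_of_monic _ hmonic,
      Finset.sum_multiset_map_count]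
    simp
  refine Eq.trans ?_ hdeg
  rw [Finset.sum_sigma', Finset.sum_sigma']
  refine Finset.sum_bij' (fun x _ => ⟨x.2.1, x.2.2⟩) (fun y _ => ⟨y.2 * y.1.natDegree, y.1, y.2⟩)
    ?_ ?_ ?_ ?_ ?_
  · rintro ⟨i, Q, k⟩ h
    simp only [mem_sigma, mem_Icc, mem_filter] at h ⊢
    obtain ⟨⟨hi, hid⟩, h, hdvd⟩ := h
    rw [mem_primePowersOfDegree (by omega)] at h
    obtain ⟨h1, h2, h3⟩ := h
    simp only at h1 h2 h3
    have hk : 1 ≤ k := by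
      rw [Nat.one_le_iff_ne_zero]
      rintro rfl
      omega
    have := (pow_dvd_iff_le_count_normalizedFactors hf.ne_zero h1 h2 k).1 hdvd
    refine ⟨?_, hk, this⟩
    rw [Multiset.mem_toFinset, ← Multiset.count_pos]
    omega
  · rintro ⟨Q, k⟩ h
    simp only [mem_sigma, mem_Icc, mem_filter, Multiset.mem_toFinset] at h ⊢
    obtain ⟨h1, hk, h2⟩ := h
    have hQi := irreducible_of_normalized_factor Q h1
    have hQm := hmonic Q h1
    have hpos : 0 < k * Q.natDegree := Nat.mul_pos hk hQi.natDegree_pos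
    have hdvd := (pow_dvd_iff_le_count_normalizedFactors hf.ne_zero hQm hQi k).2 h2
    refine ⟨⟨hpos, ?_⟩, ?_, hdvd⟩
    · have := natDegree_le_of_dvd hdvd hf.ne_zero
      rwa [natDegree_pow, hd] at this
    · rw [mem_primePowersOfDegree hpos.ne']
      exact ⟨hQm, hQi, rfl⟩
  · rintro ⟨i, Q, k⟩ h
    simp only [mem_sigma, mem_Icc, mem_filter] at h
    obtain ⟨⟨hi, hid⟩, h, hdvd⟩ := h
    rw [mem_primePowersOfDegree (by omega)] at h
    obtain ⟨h1, h2, rfl⟩ := h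
    rfl
  · intro _ _
    rfl
  · intro _ _
    rfl

variable {χ : K[X] → ℂ}

lemma sum_monicsOfDegree_dvd (hχ : ∀ f g : K[X], f.Monic → g.Monic → χ (f * g) = χ f * χ g)
    {P : K[X]} (hP : P.Monic) {d : ℕ} (hd : P.natDegree ≤ d) :
    ∑ f ∈ monicsOfDegree K d with P ∣ f, χ f = χ P * monicSum χ (d - P.natDegree) := by
  rw [monicSum, Finset.mul_sum]
  symm
  refine Finset.sum_bij (fun g _ => P * g) ?_ ?_ ?_ ?_
  · intro g hg
    rw [mem_monicsOfDegree] at hg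
    rw [mem_filter, mem_monicsOfDegree]
    refine ⟨⟨hP.mul hg.1, ?_⟩, dvd_mul_right _ _⟩
    rw [hP.natDegree_mul hg.1, hg.2]
    omega
  · intro a _ b _ h
    exact mul_left_cancel₀ hP.ne_zero h
  · intro f hf
    rw [mem_filter, mem_monicsOfDegree] at hf
    obtain ⟨⟨hf, hfd⟩, g, rfl⟩ := hf
    have hg := hP.of_mul_monic_left hf
    refine ⟨g, ?_, rfl⟩
    rw [mem_monicsOfDegree]
    rw [hP.natDegree_mul hg] at hfd
    exact ⟨hg, by omega⟩
  · intro g hg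
    rw [mem_monicsOfDegree] at hg
    rw [hχ _ _ hP hg.1]

/-- Newton's identities for a completely multiplicative function on monic polynomials. -/
lemma mul_monicSum_eq_sum (h1 : χ 1 = 1)
    (hχ : ∀ f g : K[X], f.Monic → g.Monic → χ (f * g) = χ f * χ g) (d : ℕ) :
    d * monicSum χ d = ∑ i ∈ Icc 1 d, primePowerSum χ i * monicSum χ (d - i) := by
  have : d * monicSum χ d = ∑ f ∈ monicsOfDegree K d, ∑ i ∈ Icc 1 d,
      ∑ p ∈ primePowersOfDegree K i, if p.1 ^ p.2 ∣ f then p.1.natDegree * χ f else 0 := by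
    rw [monicSum, Finset.mul_sum]
    refine Finset.sum_congr rfl fun f hf => ?_
    rw [mem_monicsOfDegree] at hf
    conv_lhs => rw [← sum_natDegree_primePowers_dvd hf.1 hf.2]
    push_cast
    simp_rw [Finset.sum_mul, Finset.sum_filter]
  rw [this, Finset.sum_comm]
  refine Finset.sum_congr rfl fun i hi => ?_
  rw [mem_Icc] at hi
  rw [Finset.sum_comm, primePowerSum, Finset.sum_mul]
  refine Finset.sum_congr rfl fun p hp => ?_
  rw [mem_primePowersOfDegree (by omega)] at hp
  obtain ⟨hm, -, hpi⟩ := hp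
  have hdeg : (p.1 ^ p.2).natDegree = i := by rw [natDegree_pow, hpi]
  rw [← Finset.sum_filter, ← Finset.mul_sum,
    sum_monicsOfDegree_dvd hχ (hm.pow _) (hdeg.trans_le hi.2), hdeg, apply_pow_of_mul h1 hχ hm,
    mul_assoc]

lemma monicSum_zero (h1 : χ 1 = 1) : monicSum χ 0 = 1 := by
  have : monicsOfDegree K 0 = {1} := by
    ext f
    rw [mem_monicsOfDegree, Finset.mem_singleton]
    constructor
    · rintro ⟨h, h'⟩
      exact h.natDegree_eq_zero.1 h'
    · rintro rfl
      simp
  rw [monicSum, this, Finset.sum_singleton, h1]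

lemma primePowerSum_eq_of_monicSum_eq_zero (h1 : χ 1 = 1)
    (hχ : ∀ f g : K[X], f.Monic → g.Monic → χ (f * g) = χ f * χ g)
    (h0 : ∀ d, 2 ≤ d → monicSum χ d = 0) {i : ℕ} (hi : i ≠ 0) :
    primePowerSum χ i = -(-monicSum χ 1) ^ i := by
  obtain ⟨k, rfl⟩ := Nat.exists_eq_add_one_of_ne_zero hi
  clear hi
  induction k with
  | zero =>
    have := mul_monicSum_eq_sum h1 hχ 1
    simpa [monicSum_zero h1] using this.symm
  | succ k ih =>
    have := mul_monicSum_eq_sum h1 hχ (k + 2)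
    rw [h0 _ (by omega), Finset.sum_Icc_succ_top (by omega), Finset.sum_Icc_succ_top (by omega),
      Finset.sum_eq_zero, ih] at this
    · simp [monicSum_zero h1] at this
      linear_combination -this
    · intro j hj
      rw [mem_Icc] at hj
      rw [h0 _ (by omega), mul_zero]

/-- If the power sums attached to `χ` are `-∑ γᵢʲ`, its sums over monic polynomials are the signed
elementary symmetric functions of the `γᵢ`. -/
lemma monicSum_eq_esymm (h1 : χ 1 = 1)
    (hχ : ∀ f g : K[X], f.Monic → g.Monic → χ (f * g) = χ f * χ g) {ι : Type*} [Fintype ι]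
    (γ : ι → ℂ) (hγ : ∀ j ≠ 0, primePowerSum χ j = -∑ i, γ i ^ j) (d : ℕ) :
    monicSum χ d = (-1) ^ d * MvPolynomial.aeval γ (MvPolynomial.esymm ι ℂ d) := by
  induction d using Nat.strong_induction_on with
  | _ d ih =>
  rcases eq_or_ne d 0 with rfl | hd
  · simp [monicSum_zero h1]
  have hN := congrArg (MvPolynomial.aeval γ) (MvPolynomial.mul_esymm_eq_sum ι ℂ d)
  have hM := mul_monicSum_eq_sum h1 hχ d
  have hsum : ∑ i ∈ Icc 1 d, primePowerSum χ i * monicSum χ (d - i) =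
      -∑ a ∈ antidiagonal d with a.1 < d, (-1) ^ a.1 *
        MvPolynomial.aeval γ (MvPolynomial.esymm ι ℂ a.1) *
        MvPolynomial.aeval γ (MvPolynomial.psum ι ℂ a.2) := by
    rw [← Finset.sum_neg_distrib]
    refine Finset.sum_bij (fun i _ => (d - i, i)) ?_ ?_ ?_ ?_
    · intro i hi
      simp only [mem_Icc, mem_filter, HasAntidiagonal.mem_antidiagonal] at hi ⊢
      omega
    · intro i _ j _ h
      exact (Prod.ext_iff.1 h).2
    · rintro ⟨a, b⟩ h
      simp only [mem_filter, HasAntidiagonal.mem_antidiagonal] at h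
      exact ⟨b, by rw [mem_Icc]; omega, by ext <;> simp; omega⟩
    · intro i hi
      rw [mem_Icc] at hi
      rw [hγ i (by omega), ih _ (by omega), MvPolynomial.psum]
      simp only [map_sum, map_pow, MvPolynomial.aeval_X]
      ring
  rw [hsum] at hM
  simp only [map_mul, map_natCast, map_pow, map_neg, map_one, map_sum] at hN
  have hd' : (d : ℂ) ≠ 0 := Nat.cast_ne_zero.2 hd
  apply mul_left_cancel₀ hd'
  rw [hM]
  have hs : ((-1 : ℂ) ^ d) * (-1) ^ d = 1 := by rw [← mul_pow]; simp
  rw [pow_succ] at hN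
  linear_combination (-(-1) ^ d) * hN + (∑ a ∈ antidiagonal d with a.1 < d, (-1) ^ a.1 *
        MvPolynomial.aeval γ (MvPolynomial.esymm ι ℂ a.1) *
        MvPolynomial.aeval γ (MvPolynomial.psum ι ℂ a.2)) * hs

end MonicPolynomials

section Extensions

open Polynomial IntermediateField Module

variable {K L : Type*} [Field K] [Field L] [Algebra K L]

lemma trace_gen_pow_eq_rootPowerSum [FiniteDimensional K L] [Algebra.IsSeparable K L]
    (pb : PowerBasis K L) {m : ℕ} (hm : m ≠ 0) :
    Algebra.trace K L (pb.gen ^ m) = rootPowerSum m (minpoly K pb.gen) := by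
  let E := AlgebraicClosure K
  apply (algebraMap K E).injective
  rw [map_rootPowerSum_eq_sum_aroots (minpoly.monic pb.isIntegral_gen)
    (IsAlgClosed.splits _) hm, trace_eq_sum_embeddings E]
  have hnodup : ((minpoly K pb.gen).aroots E).Nodup :=
    nodup_roots ((separable_map _).mpr (Algebra.IsSeparable.isSeparable K pb.gen))
  rw [Fintype.sum_equiv pb.liftEquiv' _ (fun y => (y : E) ^ m)]
  · rw [Finset.sum_mem_multiset _ _ (fun a : E => a ^ m) (fun _ => rfl),
      Finset.sum_eq_multiset_sum, Multiset.toFinset_val, Multiset.dedup_eq_self.mpr hnodup]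
  · intro σ
    rw [PowerBasis.liftEquiv'_apply_coe, map_pow]

lemma trace_pow_eq_rootPowerSum [FiniteDimensional K L] [Algebra.IsSeparable K L] (x : L) {m : ℕ}
    (hm : m ≠ 0) :
    Algebra.trace K L (x ^ m) = finrank K⟮x⟯ L • rootPowerSum m (minpoly K x) := by
  have hx := Algebra.IsIntegral.isIntegral (R := K) x
  have : Algebra.IsSeparable K K⟮x⟯ := Algebra.isSeparable_tower_bot_of_isSeparable K K⟮x⟯ L
  have hxm : x ^ m = algebraMap K⟮x⟯ L (AdjoinSimple.gen K x ^ m) := by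
    rw [map_pow, AdjoinSimple.algebraMap_gen]
  rw [← Algebra.trace_trace (S := K⟮x⟯), hxm, Algebra.trace_algebraMap, map_nsmul,
    ← adjoin.powerBasis_gen hx, trace_gen_pow_eq_rootPowerSum _ hm, adjoin.powerBasis_gen, minpoly_gen]

lemma norm_eq_minpoly_coeff_pow [FiniteDimensional K L] [Algebra.IsSeparable K L] (x : L) :
    Algebra.norm K x =
      ((-1) ^ (minpoly K x).natDegree * (minpoly K x).coeff 0) ^ finrank K⟮x⟯ L := by
  have hx := Algebra.IsIntegral.isIntegral (R := K) x
  rw [Algebra.norm_eq_norm_adjoin, ← adjoin.powerBasis_gen hx,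
    Algebra.PowerBasis.norm_gen_eq_coeff_zero_minpoly, adjoin.powerBasis_gen, minpoly_gen,
    adjoin.powerBasis_dim]

lemma finrank_mul_natDegree_minpoly [FiniteDimensional K L] (x : L) :
    finrank K⟮x⟯ L * (minpoly K x).natDegree = finrank K L := by
  rw [← adjoin.finrank (Algebra.IsIntegral.isIntegral (R := K) x), mul_comm,
    finrank_mul_finrank]

lemma card_filter_minpoly_eq [Finite K] [Fintype L] {Q : K[X]} (hQ : Q.Monic) (hQi : Irreducible Q)
    (hd : Q.natDegree ∣ finrank K L) :
    (Finset.univ.filter fun x : L => minpoly K x = Q).card = Q.natDegree := by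
  have hdvd := hQi.natDegree_dvd_iff_dvd_X_pow_card_pow_sub_X.1 hd
  rw [← natCard_eq_pow_finrank (V := L), Nat.card_eq_fintype_card] at hdvd
  have hsplits : (Q.map (algebraMap K L)).Splits := by
    refine Splits.of_dvd (FiniteField.isSplittingField_sub L K).splits ?_ (Polynomial.map_dvd _ hdvd)
    exact Polynomial.map_ne_zero
      (FiniteField.X_pow_card_sub_X_ne_zero K Fintype.one_lt_card)
  rw [← card_rootSet_eq_natDegree (PerfectField.separable_of_irreducible hQi) hsplits,
    ← Set.toFinset_card]
  congr 1
  ext x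
  rw [Finset.mem_filter, Set.mem_toFinset, mem_rootSet]
  constructor
  · rintro ⟨-, rfl⟩
    exact ⟨hQ.ne_zero, minpoly.aeval K x⟩
  · rintro ⟨-, h⟩
    exact ⟨Finset.mem_univ _, (minpoly.eq_of_irreducible_of_monic hQi h hQ).symm⟩

/-- Sums over prime powers of degree `i` are sums over the extension of degree `i`. -/
lemma primePowerSum_eq_sum_minpoly [Finite K] [Fintype L] (χ : K[X] → ℂ) :
    primePowerSum χ (finrank K L) = ∑ x : L, χ (minpoly K x) ^ finrank K⟮x⟯ L := by
  have h0 : finrank K L ≠ 0 := (finrank_pos (R := K) (M := L)).ne'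
  rw [primePowerSum, ← Finset.sum_fiberwise_of_maps_to (s := Finset.univ)
    (t := primePowersOfDegree K (finrank K L)) (g := fun x : L => (minpoly K x, finrank K⟮x⟯ L))]
  · refine Finset.sum_congr rfl fun p hp => ?_
    rw [mem_primePowersOfDegree h0] at hp
    obtain ⟨hm, hi, hd⟩ := hp
    have hfilter : (Finset.univ.filter fun x : L => (minpoly K x, finrank K⟮x⟯ L) = p) =
        Finset.univ.filter fun x : L => minpoly K x = p.1 := by
      ext x
      simp only [Finset.mem_filter, Finset.mem_univ, true_and, Prod.ext_iff, and_iff_left_iff_imp]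
      intro h
      have := finrank_mul_natDegree_minpoly (K := K) x
      rw [h, ← hd] at this
      exact Nat.eq_of_mul_eq_mul_right hi.natDegree_pos this
    rw [Finset.sum_congr rfl (g := fun _ => χ p.1 ^ p.2), Finset.sum_const, hfilter,
      card_filter_minpoly_eq hm hi (Dvd.intro_left _ hd), nsmul_eq_mul]
    intro x hx
    rw [Finset.mem_filter] at hx
    rw [← hx.2]
  · intro x _
    rw [mem_primePowersOfDegree h0]
    have hx := Algebra.IsIntegral.isIntegral (R := K) x
    exact ⟨minpoly.monic hx, minpoly.irreducible hx, finrank_mul_natDegree_minpoly x⟩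

end Extensions

section CharacterOnPolynomials

open Polynomial IntermediateField Module

variable {K : Type*} [Field K]

/-- The completely multiplicative function `f ↦ β(∏ a) ψ(∑ aᵐ)` on monic polynomials
`f = ∏ (X - a)`. -/
def polyChar (ψ : AddChar K ℂ) (β : MulChar K ℂ) (m : ℕ) (f : K[X]) : ℂ :=
  β ((-1) ^ f.natDegree * f.coeff 0) * ψ (rootPowerSum m f)

variable (ψ : AddChar K ℂ) (β : MulChar K ℂ) (m : ℕ)

lemma polyChar_one : polyChar ψ β m 1 = 1 := by
  simp [polyChar]

lemma polyChar_mul (f g : K[X]) (hf : f.Monic) (hg : g.Monic) :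
    polyChar ψ β m (f * g) = polyChar ψ β m f * polyChar ψ β m g := by
  simp only [polyChar, hf.natDegree_mul hg, mul_coeff_zero, rootPowerSum_mul hf hg,
    AddChar.map_add_eq_mul, pow_add, map_mul]
  ring

lemma polyChar_minpoly_pow {L : Type*} [Field L] [Algebra K L] [FiniteDimensional K L]
    [Algebra.IsSeparable K L] {m : ℕ} (hm : m ≠ 0) (x : L) :
    polyChar ψ β m (minpoly K x) ^ finrank K⟮x⟯ L =
      β (Algebra.norm K x) * ψ (Algebra.trace K L (x ^ m)) := by
  rw [polyChar, mul_pow, ← map_pow, ← AddChar.map_nsmul_eq_pow, ← norm_eq_minpoly_coeff_pow,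
    ← trace_pow_eq_rootPowerSum x hm]

lemma primePowerSum_polyChar [Finite K] {L : Type*} [Field L] [Algebra K L] [Fintype L]
    {m : ℕ} (hm : m ≠ 0) :
    primePowerSum (polyChar ψ β m) (finrank K L) =
      ∑ x : L, β (Algebra.norm K x) * ψ (Algebra.trace K L (x ^ m)) := by
  rw [primePowerSum_eq_sum_minpoly]
  exact Finset.sum_congr rfl fun x _ => polyChar_minpoly_pow ψ β hm x

lemma rootPowerSum_one_eq {f : K[X]} (hf : f.Monic) : rootPowerSum 1 f = -f.nextCoeff := by
  apply (algebraMap K (AlgebraicClosure K)).injective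
  rw [map_rootPowerSum_eq_sum_aroots hf (IsAlgClosed.splits _) one_ne_zero]
  have := (IsAlgClosed.splits
    (f.map (algebraMap K (AlgebraicClosure K)))).nextCoeff_eq_neg_sum_roots_of_monic (hf.map _)
  rw [nextCoeff_map (algebraMap K (AlgebraicClosure K)).injective] at this
  rw [map_neg, this, aroots]
  simp

variable [Finite K]

lemma add_mem_monicsOfDegree {d j : ℕ} (hj : j < d) (c : K) {f : K[X]}
    (hf : f ∈ monicsOfDegree K d) : f + C c * X ^ j ∈ monicsOfDegree K d := by
  rw [mem_monicsOfDegree] at hf ⊢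
  obtain ⟨hf, hd⟩ := hf
  have hdeg : (C c * X ^ j).degree < f.degree := by
    refine (degree_C_mul_X_pow_le j c).trans_lt ?_
    rw [degree_eq_natDegree hf.ne_zero, hd]
    exact_mod_cast hj
  refine ⟨hf.add_of_left hdeg, ?_⟩
  rw [natDegree_add_eq_left_of_degree_lt hdeg, hd]

variable {ψ}

lemma monicSum_polyChar_one_eq_zero (hψ : ψ ≠ 1) {d : ℕ} (hd : 2 ≤ d) :
    monicSum (polyChar ψ β 1) d = 0 := by
  obtain ⟨c, hc⟩ := AddChar.ne_one_iff.1 hψ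
  have key : monicSum (polyChar ψ β 1) d = ψ c * monicSum (polyChar ψ β 1) d := by
    rw [monicSum, Finset.mul_sum]
    refine Finset.sum_bij' (fun f _ => f + C c * X ^ (d - 1)) (fun f _ => f + C (-c) * X ^ (d - 1))
      ?_ ?_ ?_ ?_ ?_
    · exact fun f hf => add_mem_monicsOfDegree (by omega) c hf
    · exact fun f hf => add_mem_monicsOfDegree (by omega) (-c) hf
    · intro f _
      simp
    · intro f _
      simp
    · intro f hf
      have hg := add_mem_monicsOfDegree (j := d - 1) (by omega) c hf
      rw [mem_monicsOfDegree] at hf hg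
      have h0 : (f + C c * X ^ (d - 1)).coeff 0 = f.coeff 0 := by
        rw [coeff_add, coeff_C_mul, coeff_X_pow, if_neg (by omega), mul_zero, add_zero]
      have h1 : (f + C c * X ^ (d - 1)).nextCoeff = f.nextCoeff + c := by
        rw [nextCoeff_of_natDegree_pos (by omega), nextCoeff_of_natDegree_pos (by omega), hg.2, hf.2]
        simp
      rw [polyChar, polyChar, rootPowerSum_one_eq hf.1, rootPowerSum_one_eq hg.1, h0, h1, hf.2, hg.2,
        show -f.nextCoeff = c + -(f.nextCoeff + c) by ring, AddChar.map_add_eq_mul]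
      ring
  have h : (1 - ψ c) * monicSum (polyChar ψ β 1) d = 0 := by linear_combination key
  exact (mul_eq_zero.1 h).resolve_left (sub_ne_zero.2 hc.symm)

/-- The sum over monic polynomials of degree `n` factors through the constant term. -/
lemma monicSum_polyChar_self [Fintype K] (ψ : AddChar K ℂ) {n : ℕ} (hn : n ≠ 0) :
    monicSum (polyChar ψ β n) n =
      (∑ h ∈ monicsOfDegree K n with h.coeff 0 = 0, ψ (rootPowerSum n h)) *
        ∑ c : K, β ((-1) ^ n * c) * ψ (-(n * c)) := by
  rw [monicSum, Finset.sum_mul_sum, ← Finset.sum_product']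
  refine Finset.sum_bij' (fun f _ => (f + C (-f.coeff 0), f.coeff 0)) (fun p _ => p.1 + C p.2)
    ?_ ?_ ?_ ?_ ?_
  · intro f hf
    rw [Finset.mem_product, Finset.mem_filter]
    refine ⟨⟨?_, by simp⟩, Finset.mem_univ _⟩
    simpa using add_mem_monicsOfDegree (Nat.pos_of_ne_zero hn) (-f.coeff 0) hf
  · intro p hp
    rw [Finset.mem_product, Finset.mem_filter] at hp
    simpa using add_mem_monicsOfDegree (Nat.pos_of_ne_zero hn) p.2 hp.1.1
  · intro f _
    simp
  · rintro ⟨f, c⟩ hp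
    rw [Finset.mem_product, Finset.mem_filter] at hp
    simp [hp.1.2]
  · intro f hf
    rw [mem_monicsOfDegree] at hf
    rw [polyChar, rootPowerSum_add_C hn hf.1 hf.2, hf.2, mul_left_comm, ← AddChar.map_add_eq_mul]
    congr 2
    ring

end CharacterOnPolynomials

section TorsionCharacters

open Finset

lemma IsCyclic.exists_pow_eq_of_pow_eq_one {G : Type*} [CommGroup G] [IsCyclic G] [Finite G]
    {a b : ℕ} (hab : a * b = Nat.card G) {g : G} (hg : g ^ b = 1) : ∃ h : G, h ^ a = g := by
  obtain ⟨c, hc⟩ := IsCyclic.exists_generator (α := G)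
  obtain ⟨k, rfl⟩ := mem_powers_iff_mem_zpowers.2 (hc g)
  have hb : 0 < b := Nat.pos_of_ne_zero fun h => by
    rw [h, mul_zero] at hab
    exact Nat.card_pos.ne hab
  have hdvd : Nat.card G ∣ k * b := by
    rw [← orderOf_eq_card_of_forall_mem_zpowers hc]
    apply orderOf_dvd_of_pow_eq_one
    simpa [pow_mul] using hg
  rw [← hab] at hdvd
  obtain ⟨j, rfl⟩ := Nat.dvd_of_mul_dvd_mul_right hb hdvd
  exact ⟨c ^ j, by simp only [← pow_mul, mul_comm]⟩

lemma IsCyclic.card_filter_pow_eq {G : Type*} [CommGroup G] [IsCyclic G] [Fintype G]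
    {a b : ℕ} (hab : a * b = Nat.card G) (g : G) [DecidablePred fun h : G => h ^ a = g]
    [Decidable (g ^ b = 1)] :
    (univ.filter fun h : G => h ^ a = g).card = if g ^ b = 1 then a else 0 := by
  split_ifs with hg
  · obtain ⟨h, rfl⟩ := IsCyclic.exists_pow_eq_of_pow_eq_one hab hg
    have hker := IsCyclic.card_powMonoidHom_ker (G := G) a
    rw [← hab, Nat.gcd_mul_right_left] at hker
    refine Eq.trans ?_ hker
    rw [Nat.card_eq_fintype_card, ← Fintype.card_subtype]
    refine Fintype.card_congr ((Equiv.mulRight h⁻¹).subtypeEquiv fun k => ?_)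
    simp [MonoidHom.mem_ker, mul_pow, mul_inv_eq_one]
  · rw [Finset.card_eq_zero, Finset.filter_eq_empty_iff]
    rintro h - rfl
    exact hg (by rw [← pow_mul, hab, pow_card_eq_one'])

variable {K : Type*} [Field K] [Fintype K]

instance isCyclic_mulChar : IsCyclic (MulChar K ℂ) :=
  have e := (MulChar.mulEquiv_units K ℂ).some
  isCyclic_of_surjective e.symm e.symm.surjective

lemma natCard_mulChar : Nat.card (MulChar K ℂ) = Fintype.card K - 1 := by
  rw [MulChar.card_eq_card_units_of_hasEnoughRootsOfUnity, Nat.card_units, Nat.card_eq_fintype_card]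

lemma card_torsion_mulChar {n : ℕ} (hn : n ∣ Fintype.card K - 1) :
    (univ.filter fun φ : MulChar K ℂ => φ ^ n = 1).card = n := by
  obtain ⟨b, hb⟩ := hn
  rw [IsCyclic.card_filter_pow_eq (b := b) (by rw [natCard_mulChar, hb])]
  simp

lemma sum_torsion_mulChar {a b : ℕ} (hab : a * b = Fintype.card K - 1) (u : Kˣ) :
    ∑ φ : MulChar K ℂ with φ ^ a = 1, φ u = if u ^ b = 1 then (a : ℂ) else 0 := by
  split_ifs with hu
  · rw [Finset.sum_congr rfl (g := fun _ => 1), Finset.sum_const,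
      card_torsion_mulChar ⟨b, hab.symm⟩, nsmul_one]
    intro φ hφ
    obtain ⟨χ, rfl⟩ := IsCyclic.exists_pow_eq_of_pow_eq_one (a := b) (b := a)
      (by rw [natCard_mulChar, mul_comm, hab]) (mem_filter.1 hφ).2
    rw [MulChar.pow_apply_coe, ← map_pow, ← Units.val_pow_eq_pow_val, hu, Units.val_one, map_one]
  · obtain ⟨χ, hχ⟩ := MulChar.exists_apply_ne_one_of_hasEnoughRootsOfUnity K ℂ
      (a := ((u ^ b : Kˣ) : K)) (by rwa [Ne, Units.val_eq_one])
    have hχb : (χ ^ b) u ≠ 1 := by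
      rwa [MulChar.pow_apply_coe, ← map_pow, ← Units.val_pow_eq_pow_val]
    have hχab : (χ ^ b) ^ a = 1 := by
      rw [← pow_mul, mul_comm, hab, ← natCard_mulChar, pow_card_eq_one']
    have key : ∑ φ : MulChar K ℂ with φ ^ a = 1, φ u =
        (χ ^ b) u * ∑ φ : MulChar K ℂ with φ ^ a = 1, φ u := by
      rw [Finset.mul_sum]
      symm
      refine Finset.sum_bij (fun φ _ => χ ^ b * φ) ?_ ?_ ?_ ?_
      · intro φ hφ
        rw [mem_filter] at hφ ⊢
        exact ⟨mem_univ _, by rw [mul_pow, hχab, hφ.2, one_mul]⟩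
      · intro _ _ _ _ h
        exact mul_left_cancel h
      · intro φ hφ
        rw [mem_filter] at hφ
        refine ⟨(χ ^ b)⁻¹ * φ, ?_, by simp⟩
        rw [mem_filter]
        exact ⟨mem_univ _, by rw [mul_pow, inv_pow, hχab, hφ.2, inv_one, one_mul]⟩
      · intro φ _
        rw [MulChar.mul_apply]
    have h : (1 - (χ ^ b) u) * ∑ φ : MulChar K ℂ with φ ^ a = 1, φ u = 0 := by
      linear_combination key
    exact (mul_eq_zero.1 h).resolve_left (sub_ne_zero.2 hχb.symm)

/-- The number of `n`-th roots of `x` in a finite extension of a finite field containing the `n`-th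
roots of unity, in terms of characters of the norm. -/
lemma card_filter_pow_eq_sum_mulChar_norm {L : Type*} [Field L] [Algebra K L] [Fintype L] {n : ℕ}
    (hn : n ∣ Fintype.card K - 1) {x : L} (hx : x ≠ 0) :
    ((univ.filter fun y : L => y ^ n = x).card : ℂ) =
      ∑ φ : MulChar K ℂ with φ ^ n = 1, φ (Algebra.norm K x) := by
  obtain ⟨b, hb⟩ := hn
  have hK : 0 < Fintype.card K - 1 := Nat.sub_pos_of_lt Fintype.one_lt_card
  have hn0 : n ≠ 0 := by
    rintro rfl
    omega
  have hdvd : Fintype.card K - 1 ∣ Fintype.card L - 1 := by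
    rw [Module.card_eq_pow_finrank (K := K) (V := L)]
    simpa using Nat.sub_dvd_pow_sub_pow (Fintype.card K) 1 (Module.finrank K L)
  obtain ⟨t, ht⟩ := hdvd
  lift x to Lˣ using hx.isUnit
  have hN : Algebra.norm K (x : L) ≠ 0 := Algebra.norm_ne_zero_iff.2 x.ne_zero
  have hsum := sum_torsion_mulChar hb.symm (Units.mk0 _ hN)
  rw [Units.val_mk0] at hsum
  have hroots : (univ.filter fun y : L => y ^ n = x).card =
      (univ.filter fun y : Lˣ => y ^ n = x).card := by
    symm
    refine Finset.card_bij (fun y _ => (y : L)) ?_ ?_ ?_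
    · intro y hy
      rw [mem_filter] at hy ⊢
      exact ⟨mem_univ _, by rw [← Units.val_pow_eq_pow_val, hy.2]⟩
    · intro _ _ _ _ h
      exact Units.ext h
    · intro y hy
      rw [mem_filter] at hy
      have hy0 : y ≠ 0 := by
        rintro rfl
        rw [zero_pow hn0] at hy
        exact x.ne_zero hy.2.symm
      refine ⟨Units.mk0 y hy0, ?_, rfl⟩
      rw [mem_filter]
      exact ⟨mem_univ _, Units.ext (by simpa using hy.2)⟩
  have hL : n * (b * t) = Nat.card Lˣ := by
    rw [Nat.card_units, Nat.card_eq_fintype_card, ht, hb, mul_assoc]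
  have hiff : Units.mk0 _ hN ^ b = 1 ↔ x ^ (b * t) = 1 := by
    rw [Units.ext_iff, Units.ext_iff, ← (algebraMap K L).injective.eq_iff]
    simp only [Units.val_pow_eq_pow_val, Units.val_mk0, map_pow, Units.val_one, map_one]
    rw [FiniteField.algebraMap_norm_eq_pow, Nat.card_eq_fintype_card, Nat.card_eq_fintype_card, ht,
      Nat.mul_div_cancel_left _ hK, ← pow_mul, mul_comm t]
  rw [hsum, hroots, IsCyclic.card_filter_pow_eq hL]
  simp only [hiff]
  split_ifs <;> simp

end TorsionCharacters

section Assembly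

open Finset

variable {ψ : AddChar κ ℂ}

lemma gS_eq_neg_gaussSum (ψ : AddChar κ ℂ) (φ : MulChar κ ℂ) : gS ψ φ = -gaussSum φ ψ := by
  simp only [gS, gaussSum, mul_comm]

lemma gS_one (hψ : ψ ≠ 1) : gS ψ 1 = 1 := by
  rw [gS_eq_neg_gaussSum, gaussSum_one_left hψ, neg_neg]

lemma gS_ne_zero (hψ : ψ ≠ 1) (φ : MulChar κ ℂ) : gS ψ φ ≠ 0 := by
  rcases eq_or_ne φ 1 with rfl | hφ
  · rw [gS_one hψ]
    exact one_ne_zero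
  · rw [gS_eq_neg_gaussSum]
    exact neg_ne_zero.2 (gaussSum_ne_zero_of_nontrivial
      (Nat.cast_ne_zero.2 Fintype.card_ne_zero) hφ (AddChar.IsPrimitive.of_ne_one hψ))

lemma monicSum_polyChar_one_one (ψ : AddChar κ ℂ) (β : MulChar κ ℂ) :
    monicSum (polyChar ψ β 1) 1 = -gS ψ β := by
  have hX : {h ∈ monicsOfDegree κ 1 | h.coeff 0 = 0} = {(Polynomial.X : Polynomial κ)} := by
    ext f
    rw [mem_filter, mem_monicsOfDegree, mem_singleton]
    constructor
    · rintro ⟨⟨hf, hd⟩, h0⟩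
      rw [hf.eq_X_add_C hd, h0, map_zero, add_zero]
    · rintro rfl
      simp
  have h0 : rootPowerSum 1 (Polynomial.X : Polynomial κ) = 0 := by
    simpa using rootPowerSum_X_sub_C one_ne_zero (0 : κ)
  rw [monicSum_polyChar_self β ψ one_ne_zero, hX, sum_singleton, h0, AddChar.map_zero_eq_one,
    one_mul, gS, neg_neg]
  refine Fintype.sum_equiv (Equiv.neg κ) _ _ fun c => ?_
  simp [mul_comm]

lemma primePowerSum_polyChar_one (hψ : ψ ≠ 1) (β : MulChar κ ℂ) {j : ℕ} (hj : j ≠ 0) :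
    primePowerSum (polyChar ψ β 1) j = -gS ψ β ^ j := by
  rw [primePowerSum_eq_of_monicSum_eq_zero (polyChar_one ψ β 1) (polyChar_mul ψ β 1)
    (fun d hd => monicSum_polyChar_one_eq_zero β hψ hd) hj, monicSum_polyChar_one_one, neg_neg]

lemma exists_extension_finrank_eq (κ : Type*) [Field κ] [Fintype κ] {j : ℕ} (hj : j ≠ 0) :
    ∃ (L : Type) (_ : Field L) (_ : Algebra κ L) (_ : Fintype L), Module.finrank κ L = j := by
  obtain ⟨p, hp⟩ := CharP.exists κ
  have : Fact p.Prime := ⟨CharP.char_is_prime κ p⟩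
  have : NeZero j := ⟨hj⟩
  exact ⟨FiniteField.Extension κ p j, inferInstance, inferInstance, Fintype.ofFinite _,
    FiniteField.finrank_extension κ p j⟩

lemma primePowerSum_polyChar_pow (ψ : AddChar κ ℂ) (α : MulChar κ ℂ) {n : ℕ} (hn : n ≠ 0)
    (hdvd : n ∣ Fintype.card κ - 1) {j : ℕ} (hj : j ≠ 0) :
    primePowerSum (polyChar ψ (α ^ n) n) j =
      ∑ φ : MulChar κ ℂ with φ ^ n = 1, primePowerSum (polyChar ψ (α * φ) 1) j := by
  obtain ⟨L, _, _, _, rfl⟩ := exists_extension_finrank_eq κ hj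
  have hfiber : ∑ y : L, (α ^ n) (Algebra.norm κ y) * ψ (Algebra.trace κ L (y ^ n)) =
      ∑ x : L, ((univ.filter fun y : L => y ^ n = x).card : ℂ) *
        (α (Algebra.norm κ x) * ψ (Algebra.trace κ L x)) := by
    rw [← Finset.sum_fiberwise univ fun y : L => y ^ n]
    refine Finset.sum_congr rfl fun x _ => ?_
    rw [← nsmul_eq_mul, ← Finset.sum_const]
    refine Finset.sum_congr rfl fun y hy => ?_
    rw [← (mem_filter.1 hy).2, MulChar.pow_apply' _ hn, map_pow (Algebra.norm κ), map_pow α]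
  rw [primePowerSum_polyChar ψ _ hn, hfiber]
  simp_rw [primePowerSum_polyChar ψ _ one_ne_zero, pow_one]
  rw [Finset.sum_comm]
  refine Finset.sum_congr rfl fun x _ => ?_
  rcases eq_or_ne x 0 with rfl | hx
  · simp only [Algebra.norm_zero, MulChar.map_zero, zero_mul, mul_zero, Finset.sum_const_zero]
  · rw [card_filter_pow_eq_sum_mulChar_norm hdvd hx, Finset.sum_mul]
    refine Finset.sum_congr rfl fun φ _ => ?_
    rw [MulChar.mul_apply]
    ring

lemma monicSum_polyChar_pow (hψ : ψ ≠ 1) (α : MulChar κ ℂ) {n : ℕ} (hn : n ≠ 0)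
    (hdvd : n ∣ Fintype.card κ - 1) :
    monicSum (polyChar ψ (α ^ n) n) n =
      (-1) ^ n * ∏ φ : MulChar κ ℂ with φ ^ n = 1, gS ψ (α * φ) := by
  have hcard : Fintype.card {φ : MulChar κ ℂ // φ ^ n = 1} = n := by
    rw [Fintype.card_subtype, card_torsion_mulChar hdvd]
  rw [monicSum_eq_esymm (polyChar_one ψ _ n) (polyChar_mul ψ _ n)
    (fun φ : {φ : MulChar κ ℂ // φ ^ n = 1} => gS ψ (α * φ))]
  · congr 1
    have hpc := Finset.powersetCard_self (univ : Finset {φ : MulChar κ ℂ // φ ^ n = 1})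
    rw [card_univ, hcard] at hpc
    rw [MvPolynomial.esymm, hpc, sum_singleton, map_prod]
    simp only [MvPolynomial.aeval_X]
    exact (Finset.prod_subtype _ (by simp) fun φ => gS ψ (α * φ)).symm
  · intro j hj
    rw [primePowerSum_polyChar_pow ψ α hn hdvd hj,
      ← Finset.sum_subtype (univ.filter fun φ : MulChar κ ℂ => φ ^ n = 1) (by simp)
        fun φ => gS ψ (α * φ) ^ j, ← Finset.sum_neg_distrib]
    exact Finset.sum_congr rfl fun φ _ => primePowerSum_polyChar_one hψ _ hj

lemma cast_ne_zero_of_dvd_card_sub_one {n : ℕ} (hdvd : n ∣ Fintype.card κ - 1) : (n : κ) ≠ 0 := by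
  intro h
  obtain ⟨b, hb⟩ := hdvd
  have h1 : Fintype.card κ = n * b + 1 := by
    have := Fintype.card_pos (α := κ)
    omega
  have h2 := FiniteField.cast_card_eq_zero κ
  rw [h1, Nat.cast_add, Nat.cast_mul, h, zero_mul, zero_add, Nat.cast_one] at h2
  exact one_ne_zero h2

lemma apply_mul_sum_eq_neg_gS (ψ : AddChar κ ℂ) (α : MulChar κ ℂ) {n : ℕ} (hn : n ≠ 0)
    (hn0 : (n : κ) ≠ 0) :
    (α ^ n) (n : κ) * ∑ c : κ, (α ^ n) ((-1) ^ n * c) * ψ (-(n * c)) = -gS ψ (α ^ n) := by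
  rw [gS, neg_neg, Finset.mul_sum]
  refine Fintype.sum_equiv ((Equiv.mulLeft₀ (n : κ) hn0).trans (Equiv.neg κ)) _ _ fun c => ?_
  have hsign : (α ^ n) ((-1) ^ n) = (α ^ n) (-1) := by
    rw [MulChar.pow_apply' _ hn, MulChar.pow_apply' _ hn, ← map_pow, ← map_pow, ← pow_mul]
    rcases Nat.even_or_odd n with h | h
    · rw [(h.mul_left n).neg_one_pow, h.neg_one_pow]
    · rw [(h.mul h).neg_one_pow, h.neg_one_pow]
  rw [Equiv.trans_apply, Equiv.neg_apply, Equiv.mulLeft₀_apply, neg_eq_neg_one_mul ((n : κ) * c)]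
  simp only [map_mul, hsign]
  ring

end Assembly

/-- Davenport–Hasse multiplication formula: for `n ∣ q - 1`, `n ≥ 1`,
`g(αⁿ) = αⁿ(n) ∏_{φⁿ=ε} g(αφ)/g(φ)`. -/
theorem stmt_8 (ψ : AddChar κ ℂ) (hψ : ψ ≠ 1) (n : ℕ) (hn : 0 < n)
    (hdvd : n ∣ Fintype.card κ - 1) (α : MulChar κ ℂ) :
    gS ψ (α ^ n) =
      (α ^ n) (n : κ) *
        ∏ φ ∈ Finset.univ.filter (fun φ : MulChar κ ℂ => φ ^ n = 1),
          gS ψ (α * φ) / gS ψ φ := by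
  have hn0 := cast_ne_zero_of_dvd_card_sub_one (κ := κ) hdvd
  have hα := monicSum_polyChar_pow hψ α hn.ne' hdvd
  have h1 := monicSum_polyChar_pow hψ 1 hn.ne' hdvd
  rw [monicSum_polyChar_self _ ψ hn.ne'] at hα h1
  have hsα := apply_mul_sum_eq_neg_gS ψ α hn.ne' hn0
  have hs1 := apply_mul_sum_eq_neg_gS ψ 1 hn.ne' hn0
  simp only [one_pow, one_mul] at h1 hs1
  rw [gS_one hψ, MulChar.one_apply hn0.isUnit, one_mul] at hs1
  rw [hs1] at h1
  have hprod : ∏ φ : MulChar κ ℂ with φ ^ n = 1, gS ψ φ ≠ 0 :=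
    Finset.prod_ne_zero_iff.2 fun φ _ => gS_ne_zero hψ φ
  rw [Finset.prod_div_distrib, mul_div_assoc', eq_div_iff hprod]
  apply mul_left_cancel₀ (pow_ne_zero n (neg_ne_zero.2 (one_ne_zero (α := ℂ))))
  linear_combination (-gS ψ (α ^ n)) * h1 + (α ^ n) (n : κ) * hα -
    (∑ h ∈ monicsOfDegree κ n with h.coeff 0 = 0, ψ (rootPowerSum n h)) * hsα

end
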